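/- Let θ be a nonzero irrational real number, let a_k denote the partial quotients and q_k the denominators of the convergents of the continued fraction expansion of θ. Then liminf_{n→∞} n·ln(n)·min{‖n·θ‖, ‖n·θ^{−1}‖} < ∞ if and only if limsup_{k→∞} a_k/ln(q_k) > 0. -/

import Mathlib

open Filter

/-- Distance from a real number to the nearest integer. -/
noncomputable def nint (x : ℝ) : ℝ := |x - (round x : ℝ)|

/-- The Gauss map orbit of `θ`: `cfX θ 0 = θ` and `cfX θ (k+1) = 1 / (fractional part of cfX θ k)`. -/
noncomputable def cfX (θ : ℝ) : ℕ → ℝ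
  | 0 => θ
  | k + 1 => (Int.fract (cfX θ k))⁻¹

/-- The partial quotients of the continued fraction expansion of `θ`. -/
noncomputable def cfA (θ : ℝ) (k : ℕ) : ℤ := ⌊cfX θ k⌋

/-- The denominators of the convergents of the continued fraction expansion of `θ`. -/
noncomputable def cfQ (θ : ℝ) : ℕ → ℤ
  | 0 => 1
  | 1 => cfA θ 1
  | (k + 2) => cfA θ (k + 2) * cfQ θ (k + 1) + cfQ θ k

/-- The numerators of the convergents of the continued fraction expansion of `θ`. -/
noncomputable def cfP (θ : ℝ) : ℕ → ℤ
  | 0 => cfA θ 0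
  | 1 => cfA θ 1 * cfA θ 0 + 1
  | (k + 2) => cfA θ (k + 2) * cfP θ (k + 1) + cfP θ k

/-- The signed approximation error `q_k θ - p_k` of the `k`-th convergent. -/
noncomputable def cfD (θ : ℝ) (k : ℕ) : ℝ := cfQ θ k * θ - cfP θ k

theorem nint_le_abs_sub_intCast (x : ℝ) (z : ℤ) : nint x ≤ |x - z| := round_le x z

theorem nint_nonneg (x : ℝ) : 0 ≤ nint x := abs_nonneg _

theorem Irrational.fract_pos {x : ℝ} (hx : Irrational x) : 0 < Int.fract x := by
  refine lt_of_le_of_ne (Int.fract_nonneg x) fun h => ?_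
  apply hx.ne_int ⌊x⌋
  have := Int.floor_add_fract x
  linarith

theorem irrational_cfX {θ : ℝ} (h : Irrational θ) (k : ℕ) : Irrational (cfX θ k) := by
  induction k with
  | zero => exact h
  | succ k ih =>
    have h1 : Irrational (Int.fract (cfX θ k)) := ih.sub_intCast _
    exact h1.inv

theorem one_lt_cfX_succ {θ : ℝ} (h : Irrational θ) (k : ℕ) : 1 < cfX θ (k + 1) :=
  (one_lt_inv₀ (irrational_cfX h k).fract_pos).2 (Int.fract_lt_one _)

theorem one_le_cfA_succ {θ : ℝ} (h : Irrational θ) (k : ℕ) : 1 ≤ cfA θ (k + 1) :=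
  Int.le_floor.2 (by exact_mod_cast (one_lt_cfX_succ h k).le)

theorem cfX_sub_cfA_mul {θ : ℝ} (h : Irrational θ) (k : ℕ) :
    (cfX θ k - cfA θ k) * cfX θ (k + 1) = 1 :=
  mul_inv_cancel₀ (irrational_cfX h k).fract_pos.ne'

theorem one_le_cfQ_and_le_succ {θ : ℝ} (h : Irrational θ) (k : ℕ) :
    1 ≤ cfQ θ k ∧ cfQ θ k ≤ cfQ θ (k + 1) := by
  induction k with
  | zero => exact ⟨le_rfl, one_le_cfA_succ h 0⟩
  | succ k ih =>
    have ha := one_le_cfA_succ h (k + 1)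
    refine ⟨ih.1.trans ih.2, ?_⟩
    simp only [cfQ]
    nlinarith

theorem one_le_cfQ {θ : ℝ} (h : Irrational θ) (k : ℕ) : 1 ≤ cfQ θ k :=
  (one_le_cfQ_and_le_succ h k).1

theorem cfQ_monotone {θ : ℝ} (h : Irrational θ) : Monotone (cfQ θ) :=
  monotone_nat_of_le_succ fun k => (one_le_cfQ_and_le_succ h k).2

theorem natCast_le_cfQ {θ : ℝ} (h : Irrational θ) (k : ℕ) : (k : ℤ) ≤ cfQ θ k := by
  induction k with
  | zero => exact zero_le_one
  | succ k ih =>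
    cases k with
    | zero => exact one_le_cfA_succ h 0
    | succ k =>
      have ha := one_le_cfA_succ h (k + 1)
      have h1 := one_le_cfQ h k
      have h2 := one_le_cfQ h (k + 1)
      simp only [cfQ]
      push_cast at ih ⊢
      nlinarith

theorem cfA_mul_cfQ_le {θ : ℝ} (h : Irrational θ) (k : ℕ) :
    cfA θ (k + 1) * cfQ θ k ≤ cfQ θ (k + 1) := by
  cases k with
  | zero => simp [cfQ]
  | succ k =>
    have := one_le_cfQ h k
    simp only [cfQ]
    linarith

theorem cfQ_succ_le {θ : ℝ} (h : Irrational θ) (k : ℕ) :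
    cfQ θ (k + 1) ≤ (cfA θ (k + 1) + 1) * cfQ θ k := by
  cases k with
  | zero => simp [cfQ]
  | succ k =>
    have := (one_le_cfQ_and_le_succ h k).2
    simp only [cfQ] at this ⊢
    linarith

theorem cfD_succ_mul_cfX {θ : ℝ} (h : Irrational θ) (k : ℕ) :
    cfD θ (k + 1) * cfX θ (k + 2) = -cfD θ k := by
  induction k with
  | zero =>
    have h0 := cfX_sub_cfA_mul h 0
    have h1 := cfX_sub_cfA_mul h 1
    simp only [cfD, cfQ, cfP, cfX] at h0 h1 ⊢
    push_cast
    linear_combination (-(θ - cfA θ 0)) * h1 + (Int.fract (Int.fract θ)⁻¹)⁻¹ * h0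
  | succ k ih =>
    have h1 := cfX_sub_cfA_mul h (k + 2)
    have hD : cfD θ (k + 2) = cfA θ (k + 2) * cfD θ (k + 1) + cfD θ k := by
      simp only [cfD, cfQ, cfP]
      push_cast
      ring
    rw [hD]
    linear_combination (-cfD θ (k + 1)) * h1 + cfX θ (k + 3) * ih

theorem cfD_mul_cfD_succ_nonpos {θ : ℝ} (h : Irrational θ) (k : ℕ) :
    cfD θ k * cfD θ (k + 1) ≤ 0 := by
  have h1 := cfD_succ_mul_cfX h k
  have h2 := one_lt_cfX_succ h (k + 1)
  have h3 : cfD θ k * cfD θ (k + 1) = -(cfD θ (k + 1) ^ 2 * cfX θ (k + 2)) := by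
    linear_combination cfD θ (k + 1) * h1
  rw [h3]
  have : 0 ≤ cfD θ (k + 1) ^ 2 * cfX θ (k + 2) := by positivity
  linarith

theorem cfP_mul_cfQ_sub (θ : ℝ) (k : ℕ) :
    cfP θ (k + 1) * cfQ θ k - cfP θ k * cfQ θ (k + 1) = (-1) ^ k := by
  induction k with
  | zero => simp only [cfP, cfQ]; ring
  | succ k ih =>
    simp only [cfP, cfQ]
    rw [pow_succ]
    linear_combination -ih

theorem cfQ_mul_abs_cfD_add {θ : ℝ} (h : Irrational θ) (k : ℕ) :
    cfQ θ (k + 1) * |cfD θ k| + cfQ θ k * |cfD θ (k + 1)| = 1 := by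
  have hdet : (cfQ θ (k + 1) : ℝ) * cfD θ k - cfQ θ k * cfD θ (k + 1) = (-1) ^ k := by
    have := congrArg (Int.cast : ℤ → ℝ) (cfP_mul_cfQ_sub θ k)
    push_cast at this
    simp only [cfD]
    linear_combination this
  have hq : (0 : ℝ) < cfQ θ k := by exact_mod_cast one_le_cfQ h k
  have hq' : (0 : ℝ) < cfQ θ (k + 1) := by exact_mod_cast one_le_cfQ h (k + 1)
  have habs : |(cfQ θ (k + 1) : ℝ) * cfD θ k - cfQ θ k * cfD θ (k + 1)| = 1 := by
    rw [hdet, abs_pow, abs_neg, abs_one, one_pow]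
  have hs := cfD_mul_cfD_succ_nonpos h k
  rw [← habs]
  rcases mul_nonpos_iff.1 hs with ⟨ha, hb⟩ | ⟨ha, hb⟩
  · rw [abs_of_nonneg ha, abs_of_nonpos hb, abs_of_nonneg]
    · ring
    · nlinarith
  · rw [abs_of_nonpos ha, abs_of_nonneg hb, abs_of_nonpos]
    · ring
    · nlinarith

theorem cfQ_succ_mul_abs_cfD_le_one {θ : ℝ} (h : Irrational θ) (k : ℕ) :
    cfQ θ (k + 1) * |cfD θ k| ≤ 1 := by
  have h1 := cfQ_mul_abs_cfD_add h k
  have hq : (0 : ℝ) < cfQ θ k := by exact_mod_cast one_le_cfQ h k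
  have : 0 ≤ cfQ θ k * |cfD θ (k + 1)| := by positivity
  linarith

theorem abs_cfD_succ_le {θ : ℝ} (h : Irrational θ) (k : ℕ) : |cfD θ (k + 1)| ≤ |cfD θ k| := by
  have h1 := cfD_succ_mul_cfX h k
  have h2 := one_lt_cfX_succ h (k + 1)
  rw [← abs_neg (cfD θ k), ← h1, abs_mul, abs_of_pos (by linarith : 0 < cfX θ (k + 1 + 1))]
  exact le_mul_of_one_le_right (abs_nonneg _) h2.le

theorem one_le_cfA_add_two_mul_abs_cfD {θ : ℝ} (h : Irrational θ) (k : ℕ) :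
    1 ≤ (cfA θ (k + 1) + 2) * cfQ θ k * |cfD θ k| := by
  have h1 := cfQ_mul_abs_cfD_add h k
  have h2 := abs_cfD_succ_le h k
  have hq : (0 : ℝ) < cfQ θ k := by exact_mod_cast one_le_cfQ h k
  have h3 : (cfQ θ (k + 1) : ℝ) ≤ (cfA θ (k + 1) + 1) * cfQ θ k := by
    exact_mod_cast cfQ_succ_le h k
  have h4 := mul_le_mul_of_nonneg_left h2 hq.le
  have h5 := mul_le_mul_of_nonneg_right h3 (abs_nonneg (cfD θ k))
  linarith

/-- Convergents are best approximations of the second kind. -/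
theorem abs_cfD_le_abs_sub {θ : ℝ} (h : Irrational θ) (k : ℕ) {n p : ℤ} (hn : 0 < n)
    (hn' : n < cfQ θ (k + 1)) : |cfD θ k| ≤ |n * θ - p| := by
  have hdet := cfP_mul_cfQ_sub θ k
  have hs : ((-1 : ℤ) ^ k) * (-1) ^ k = 1 := by rw [← mul_pow]; simp
  set s : ℤ := (-1) ^ k
  obtain ⟨x, hx⟩ : ∃ x, x = s * (n * cfP θ (k + 1) - p * cfQ θ (k + 1)) := ⟨_, rfl⟩
  obtain ⟨y, hy⟩ : ∃ y, y = s * (p * cfQ θ k - n * cfP θ k) := ⟨_, rfl⟩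
  have hnxy : n = x * cfQ θ k + y * cfQ θ (k + 1) := by
    rw [hx, hy]; linear_combination (-n * s) * hdet - n * hs
  have hpxy : p = x * cfP θ k + y * cfP θ (k + 1) := by
    rw [hx, hy]; linear_combination (-p * s) * hdet - p * hs
  have hq := one_le_cfQ h k
  have hq' := one_le_cfQ h (k + 1)
  have hx0 : x ≠ 0 := by
    intro h0
    rw [h0, zero_mul, zero_add] at hnxy
    have : 0 < y := by
      by_contra! hy0
      nlinarith
    nlinarith
  have hxy : x * y ≤ 0 := by
    by_contra! hpos
    rcases mul_pos_iff.1 hpos with ⟨ha, hb⟩ | ⟨ha, hb⟩ <;> nlinarith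
  have hD : (n : ℝ) * θ - p = x * cfD θ k + y * cfD θ (k + 1) := by
    have h1 := congrArg (Int.cast : ℤ → ℝ) hnxy
    have h2 := congrArg (Int.cast : ℤ → ℝ) hpxy
    push_cast at h1 h2
    rw [h1, h2, cfD, cfD]
    ring
  have hsame : 0 ≤ (x * cfD θ k) * (y * cfD θ (k + 1)) := by
    have h1 : (x * y : ℝ) ≤ 0 := by exact_mod_cast hxy
    have := mul_nonneg_of_nonpos_of_nonpos h1 (cfD_mul_cfD_succ_nonpos h k)
    linarith
  have hx1 : (1 : ℝ) ≤ |(x : ℝ)| := by exact_mod_cast Int.one_le_abs hx0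
  calc |cfD θ k| ≤ |(x : ℝ)| * |cfD θ k| := le_mul_of_one_le_left (abs_nonneg _) hx1
    _ = |x * cfD θ k| := (abs_mul _ _).symm
    _ ≤ |x * cfD θ k + y * cfD θ (k + 1)| := by
      apply sq_le_sq.1
      nlinarith [sq_nonneg (y * cfD θ (k + 1))]
    _ = |n * θ - p| := by rw [hD]

theorem exists_cfQ_le_lt {θ : ℝ} (h : Irrational θ) {K : ℕ} {m : ℤ} (hm : cfQ θ K ≤ m) :
    ∃ k, K ≤ k ∧ cfQ θ k ≤ m ∧ m < cfQ θ (k + 1) := by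
  classical
  have hex : ∃ j, m < cfQ θ j := by
    refine ⟨m.toNat + 1, ?_⟩
    have := natCast_le_cfQ h (m.toNat + 1)
    omega
  have hspec := Nat.find_spec hex
  have hlt : K < Nat.find hex := by
    by_contra! hle
    have := cfQ_monotone h hle
    omega
  obtain ⟨k, hk⟩ : ∃ k, Nat.find hex = k + 1 := ⟨Nat.find hex - 1, by omega⟩
  refine ⟨k, by omega, ?_, hk ▸ hspec⟩
  exact not_lt.1 (Nat.find_min hex (by omega))

theorem log_cfQ_succ_le {θ : ℝ} (h : Irrational θ) {C : ℝ} (hC : 0 ≤ C) (k : ℕ)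
    (hk : cfQ θ k * Real.log (cfQ θ k) * |cfD θ k| ≤ C) :
    Real.log (cfQ θ (k + 1)) ≤ (3 * C + 2) * cfA θ (k + 1) := by
  have hq : (1 : ℝ) ≤ cfQ θ k := by exact_mod_cast one_le_cfQ h k
  have hq' : (1 : ℝ) ≤ cfQ θ (k + 1) := by exact_mod_cast one_le_cfQ h (k + 1)
  have ha : (1 : ℝ) ≤ cfA θ (k + 1) := by exact_mod_cast one_le_cfA_succ h k
  have hl := Real.log_nonneg hq
  have h1 := one_le_cfA_add_two_mul_abs_cfD h k
  have h2 : Real.log (cfQ θ k) ≤ 3 * C * cfA θ (k + 1) := by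
    calc Real.log (cfQ θ k)
        ≤ Real.log (cfQ θ k) * ((cfA θ (k + 1) + 2) * cfQ θ k * |cfD θ k|) :=
          le_mul_of_one_le_right hl h1
      _ = (cfA θ (k + 1) + 2) * (cfQ θ k * Real.log (cfQ θ k) * |cfD θ k|) := by ring
      _ ≤ (cfA θ (k + 1) + 2) * C := by gcongr
      _ ≤ 3 * C * cfA θ (k + 1) := by nlinarith
  have h3 : (cfQ θ (k + 1) : ℝ) ≤ (cfA θ (k + 1) + 1) * cfQ θ k := by
    exact_mod_cast cfQ_succ_le h k
  have h4 : Real.log (cfQ θ (k + 1)) ≤ Real.log (cfA θ (k + 1) + 1) + Real.log (cfQ θ k) := by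
    rw [← Real.log_mul (by linarith) (by linarith)]
    exact Real.log_le_log (by linarith) h3
  have h5 := Real.log_le_sub_one_of_pos (by linarith : (0 : ℝ) < cfA θ (k + 1) + 1)
  linarith

theorem frequently_le_cfA_div_log {θ : ℝ} (h : Irrational θ) {C : ℝ}
    (hf : ∃ᶠ n : ℕ in atTop, (n : ℝ) * Real.log n * nint (n * θ) ≤ C) :
    ∃ c : ℝ, 0 < c ∧ ∃ᶠ k : ℕ in atTop, c ≤ (cfA θ k : ℝ) / Real.log (cfQ θ k : ℝ) := by
  have hpos : 0 < 3 * max C 0 + 2 := by positivity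
  refine ⟨(3 * max C 0 + 2)⁻¹, inv_pos.2 hpos, ?_⟩
  rw [frequently_atTop] at hf ⊢
  intro K
  obtain ⟨n, hn, hle⟩ := hf (cfQ θ (K + 1)).toNat
  obtain ⟨k, hKk, hkn, hnk⟩ := exists_cfQ_le_lt h (m := n) (K := K + 1) (by omega)
  refine ⟨k + 1, by omega, ?_⟩
  have hq : (1 : ℝ) ≤ cfQ θ k := by exact_mod_cast one_le_cfQ h k
  have hqn : (cfQ θ k : ℝ) ≤ n := by exact_mod_cast hkn
  have hlog : 0 < Real.log (cfQ θ (k + 1)) := by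
    apply Real.log_pos
    have := natCast_le_cfQ h (k + 1)
    have h1 : 1 < cfQ θ (k + 1) := by omega
    exact_mod_cast h1
  have hD : |cfD θ k| ≤ nint (n * θ) := by
    have := abs_cfD_le_abs_sub h k (p := round (n * θ))
      (by have := one_le_cfQ h k; omega) hnk
    simpa [nint] using this
  have hk : cfQ θ k * Real.log (cfQ θ k) * |cfD θ k| ≤ max C 0 := by
    refine le_trans ?_ (hle.trans (le_max_left _ _))
    have := Real.log_nonneg hq
    have := Real.log_nonneg (hq.trans hqn)
    gcongr
  rw [le_div_iff₀ hlog, inv_mul_le_iff₀ hpos]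
  exact log_cfQ_succ_le h (le_max_right _ _) k hk

theorem nint_natAbs_round_mul_le {θ : ℝ} (hθ : θ ≠ 0) (n : ℕ) :
    nint (((round (n * θ⁻¹)).natAbs : ℝ) * θ) ≤ |θ| * nint (n * θ⁻¹) := by
  have key : |(round (n * θ⁻¹) : ℝ) * θ - n| = |θ| * nint (n * θ⁻¹) := by
    rw [nint, ← abs_mul, abs_sub_comm]
    congr 1
    field_simp
  rw [← key, Nat.cast_natAbs, Int.cast_abs]
  rcases abs_choice ((round (n * θ⁻¹) : ℤ) : ℝ) with hc | hc <;> rw [hc]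
  · exact_mod_cast nint_le_abs_sub_intCast (round (n * θ⁻¹) * θ) n
  · refine (nint_le_abs_sub_intCast _ (-n)).trans_eq ?_
    rw [← abs_neg]
    congr 1
    push_cast
    ring

theorem frequently_mul_log_mul_nint_of_inv {θ : ℝ} (hθ : θ ≠ 0) {C : ℝ}
    (hf : ∃ᶠ n : ℕ in atTop, (n : ℝ) * Real.log n * nint (n * θ⁻¹) ≤ C) :
    ∃ C' : ℝ, ∃ᶠ n : ℕ in atTop, (n : ℝ) * Real.log n * nint (n * θ) ≤ C' := by
  have hθ' : 0 < |θ| := abs_pos.2 hθ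
  set K : ℝ := |θ|⁻¹ + 1 with hK
  have hK1 : 1 ≤ K := by have : 0 < |θ|⁻¹ := by positivity
                         linarith
  refine ⟨2 * K * |θ| * C, ?_⟩
  rw [frequently_atTop] at hf ⊢
  intro N
  obtain ⟨n, hn, hle⟩ := hf (⌈K⌉₊ + ⌈|θ| * (N + 2)⌉₊ + 1)
  have hnR : (⌈K⌉₊ + ⌈|θ| * (N + 2)⌉₊ + 1 : ℝ) ≤ n := by exact_mod_cast hn
  have hc1 := Nat.le_ceil K
  have hc2 := Nat.le_ceil (|θ| * (N + 2))
  have hp2 : 0 ≤ |θ| * (N + 2) := by positivity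
  have hnK : K ≤ n := by linarith
  have hn1 : (1 : ℝ) ≤ n := hK1.trans hnK
  have hnN : (N + 2 : ℝ) ≤ n * |θ|⁻¹ := by
    rw [← div_eq_mul_inv, le_div_iff₀ hθ']
    linarith
  set m : ℕ := (round (n * θ⁻¹)).natAbs with hm
  have hround : |(m : ℝ) - n * |θ|⁻¹| ≤ 1 / 2 := by
    have h1 : (n : ℝ) * |θ|⁻¹ = |n * θ⁻¹| := by rw [abs_mul, abs_inv, Nat.abs_cast]
    rw [hm, Nat.cast_natAbs, Int.cast_abs, h1]
    refine (abs_abs_sub_abs_le_abs_sub _ _).trans ?_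
    rw [abs_sub_comm]
    exact abs_sub_round _
  obtain ⟨hlo, hhi⟩ := abs_le.1 hround
  have hmN : (N : ℝ) + 1 ≤ m := by linarith
  have hmK : (m : ℝ) ≤ K * n := by rw [hK]; linarith
  refine ⟨m, by exact_mod_cast (by linarith : (N : ℝ) ≤ m), ?_⟩
  have hm1 : (1 : ℝ) ≤ m := by have : (0 : ℝ) ≤ N := N.cast_nonneg
                               linarith
  have hlogm : Real.log m ≤ 2 * Real.log n := by
    calc Real.log m ≤ Real.log (K * n) := Real.log_le_log (by linarith) hmK
      _ = Real.log K + Real.log n := Real.log_mul (by linarith) (by linarith)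
      _ ≤ Real.log n + Real.log n := by gcongr
      _ = 2 * Real.log n := by ring
  have hl0 := Real.log_nonneg hm1
  have hln := Real.log_nonneg hn1
  have hnn := nint_nonneg (n * θ⁻¹)
  calc (m : ℝ) * Real.log m * nint (m * θ)
      ≤ (m : ℝ) * Real.log m * (|θ| * nint (n * θ⁻¹)) := by
        gcongr
        exact nint_natAbs_round_mul_le hθ n
    _ ≤ (K * n) * (2 * Real.log n) * (|θ| * nint (n * θ⁻¹)) := by gcongr
    _ = 2 * K * |θ| * (n * Real.log n * nint (n * θ⁻¹)) := by ring
    _ ≤ 2 * K * |θ| * C := by gcongr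

theorem mul_log_mul_nint_cfQ_le {θ : ℝ} (h : Irrational θ) {c : ℝ} (hc : 0 < c) (k : ℕ)
    (hk : c * Real.log (cfQ θ (k + 1)) ≤ cfA θ (k + 1)) :
    cfQ θ k * Real.log (cfQ θ k) * nint (cfQ θ k * θ) ≤ c⁻¹ := by
  have hq : (1 : ℝ) ≤ cfQ θ k := by exact_mod_cast one_le_cfQ h k
  have hqq : (cfQ θ k : ℝ) ≤ cfQ θ (k + 1) := by
    exact_mod_cast (one_le_cfQ_and_le_succ h k).2
  have haq : (cfA θ (k + 1) * cfQ θ k : ℝ) ≤ cfQ θ (k + 1) := by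
    exact_mod_cast cfA_mul_cfQ_le h k
  have hlog := Real.log_le_log (by linarith) hqq
  have hl0 := Real.log_nonneg hq
  have hD : nint (cfQ θ k * θ) ≤ |cfD θ k| := nint_le_abs_sub_intCast _ _
  have hcl : c * Real.log (cfQ θ k) ≤ cfA θ (k + 1) :=
    (mul_le_mul_of_nonneg_left hlog hc.le).trans hk
  rw [← one_div, le_div_iff₀ hc]
  calc cfQ θ k * Real.log (cfQ θ k) * nint (cfQ θ k * θ) * c
      ≤ cfQ θ k * Real.log (cfQ θ k) * |cfD θ k| * c := by gcongr
    _ = c * Real.log (cfQ θ k) * cfQ θ k * |cfD θ k| := by ring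
    _ ≤ cfA θ (k + 1) * cfQ θ k * |cfD θ k| := by gcongr
    _ ≤ cfQ θ (k + 1) * |cfD θ k| := by gcongr
    _ ≤ 1 := cfQ_succ_mul_abs_cfD_le_one h k

theorem stmt_12 (θ : ℝ) (hθ : θ ≠ 0) (hirr : Irrational θ) :
    (∃ C : ℝ, ∃ᶠ n : ℕ in atTop,
        (n : ℝ) * Real.log n * min (nint ((n : ℝ) * θ)) (nint ((n : ℝ) * θ⁻¹)) ≤ C)
    ↔ (∃ c : ℝ, 0 < c ∧ ∃ᶠ k : ℕ in atTop,
        c ≤ (cfA θ k : ℝ) / Real.log (cfQ θ k : ℝ)) := by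
  constructor
  · rintro ⟨C, hC⟩
    have hor : ∃ᶠ n : ℕ in atTop, (n : ℝ) * Real.log n * nint (n * θ) ≤ C ∨
        (n : ℝ) * Real.log n * nint (n * θ⁻¹) ≤ C := by
      refine hC.mono fun n hn => ?_
      rcases min_choice (nint ((n : ℝ) * θ)) (nint ((n : ℝ) * θ⁻¹)) with h | h <;> rw [h] at hn
      · exact Or.inl hn
      · exact Or.inr hn
    rcases frequently_or_distrib.1 hor with h | h
    · exact frequently_le_cfA_div_log hirr h
    · obtain ⟨C', hC'⟩ := frequently_mul_log_mul_nint_of_inv hθ h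
      exact frequently_le_cfA_div_log hirr hC'
  · rintro ⟨c, hc, hf⟩
    refine ⟨c⁻¹, ?_⟩
    rw [frequently_atTop] at hf ⊢
    intro N
    obtain ⟨j, hj, hle⟩ := hf (N + 2)
    obtain ⟨k, rfl⟩ : ∃ k, j = k + 1 := ⟨j - 1, by omega⟩
    have hlog : 0 < Real.log (cfQ θ (k + 1)) := by
      apply Real.log_pos
      have := natCast_le_cfQ hirr (k + 1)
      have h1 : 1 < cfQ θ (k + 1) := by omega
      exact_mod_cast h1
    have hk := natCast_le_cfQ hirr k
    obtain ⟨n, hn⟩ := Int.eq_ofNat_of_zero_le (by omega : 0 ≤ cfQ θ k)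
    refine ⟨n, by omega, ?_⟩
    have h1 := mul_log_mul_nint_cfQ_le hirr hc k ((le_div_iff₀ hlog).1 hle)
    rw [hn] at h1
    push_cast at h1
    refine le_trans ?_ h1
    have : 0 ≤ Real.log (n : ℝ) := Real.log_natCast_nonneg n
    gcongr
    exact min_le_left _ _
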